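/- arXiv:2012.03149 — 4 statements merged into one kernel-verified Lean document; each statement's English description precedes it below -/
import Mathlib

section
/- Let E be a real inner product space and let r, f be nonzero vectors in E. Set v = (1/‖r‖) • r + (1/‖f‖) • f and assume v ≠ 0. Then v is the angle bisector of r and f: ∠(v, r) = ∠(v, f) = ∠(r, f)/2, where ∠ denotes the angle between vectors. -/
open RealInnerProductSpace

namespace InnerProductGeometry

variable {V : Type*} [NormedAddCommGroup V] [InnerProductSpace ℝ V]

theorem angle_add_left_eq_angle_add_right_of_norm_eq {x y : V} (h : ‖x‖ = ‖y‖) :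
    angle (x + y) x = angle (x + y) y := by
  simp only [angle, inner_add_left, real_inner_self_eq_norm_sq, real_inner_comm x y, h, add_comm]

theorem angle_add_left_eq_half_angle_of_norm_eq {x y : V} (h : ‖x‖ = ‖y‖) (hy : y ≠ 0) :
    angle (x + y) x = angle x y / 2 := by
  have hsum := angle_eq_angle_add_add_angle_add x hy
  rw [angle_comm x (x + y), angle_comm y (x + y),
    ← angle_add_left_eq_angle_add_right_of_norm_eq h] at hsum
  linarith

end InnerProductGeometry

theorem aw_bisector {E : Type*} [NormedAddCommGroup E] [InnerProductSpace ℝ E]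
    (r f : E) (hr : r ≠ 0) (hf : f ≠ 0)
    (v : E) (hv : v = (1 / ‖r‖) • r + (1 / ‖f‖) • f) (hv0 : v ≠ 0) :
    InnerProductGeometry.angle v r = InnerProductGeometry.angle v f ∧
    InnerProductGeometry.angle v r = InnerProductGeometry.angle r f / 2 := by
  have hr' : 0 < 1 / ‖r‖ := one_div_pos.2 (norm_pos_iff.2 hr)
  have hf' : 0 < 1 / ‖f‖ := one_div_pos.2 (norm_pos_iff.2 hf)
  have hnorm : ‖(1 / ‖r‖) • r‖ = ‖(1 / ‖f‖) • f‖ := by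
    simp [norm_smul, hr, hf]
  have heq := InnerProductGeometry.angle_add_left_eq_angle_add_right_of_norm_eq hnorm
  have hhalf := InnerProductGeometry.angle_add_left_eq_half_angle_of_norm_eq hnorm
    (smul_ne_zero hf'.ne' hf)
  rw [← hv, InnerProductGeometry.angle_smul_right_of_pos _ _ hr'] at heq hhalf
  rw [InnerProductGeometry.angle_smul_right_of_pos _ _ hf'] at heq hhalf
  rw [InnerProductGeometry.angle_smul_left_of_pos _ _ hr'] at hhalf
  exact ⟨heq, hhalf⟩
end

section
/- Let w_r, w_f be real numbers with w_r > 0 and w_f > 0, and let p, q be real numbers with p ≥ 0, q ≥ 0 and w_r·p + w_f·q > 0. Then for every real t with 0 < t < 1, w_r·p·log t + w_f·q·log(1 − t) ≤ w_r·p·log(w_r·p/(w_r·p + w_f·q)) + w_f·q·log(w_f·q/(w_r·p + w_f·q)), where log denotes the real natural logarithm with the convention log 0 = 0. -/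
/-- The tangent-line form of Gibbs' inequality for a single term. -/
theorem mul_log_le_mul_log_div_add {a s t : ℝ} (ha : 0 ≤ a) (hs : 0 < s) (ht : 0 < t) :
    a * Real.log t ≤ a * Real.log (a / s) + (s * t - a) := by
  rcases ha.eq_or_lt with rfl | ha
  · simpa using (mul_pos hs ht).le
  · have h := Real.log_le_sub_one_of_pos (div_pos ht (div_pos ha hs))
    rw [Real.log_div ht.ne' (div_pos ha hs).ne'] at h
    have h' := mul_le_mul_of_nonneg_left h ha.le
    have e : a * (t / (a / s) - 1) = s * t - a := by field_simp
    linarith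

theorem pointwise_discriminator_opt (wr wf p q : ℝ) (hwr : 0 < wr) (hwf : 0 < wf)
    (hp : 0 ≤ p) (hq : 0 ≤ q) (hpos : 0 < wr * p + wf * q) :
    ∀ t : ℝ, 0 < t → t < 1 →
      wr * p * Real.log t + wf * q * Real.log (1 - t) ≤
        wr * p * Real.log (wr * p / (wr * p + wf * q)) +
          wf * q * Real.log (wf * q / (wr * p + wf * q)) := by
  intro t ht ht1
  have h₁ := mul_log_le_mul_log_div_add (mul_nonneg hwr.le hp) hpos ht
  have h₂ := mul_log_le_mul_log_div_add (mul_nonneg hwf.le hq) hpos (sub_pos.mpr ht1)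
  linarith
end

section
/- Let (X, 𝒜, μ) be a measure space, let p, q : X → ℝ be measurable functions with p ≥ 0, q ≥ 0, ∫ p dμ = 1 and ∫ q dμ = 1, and let w_r, w_f > 0 be real numbers. Assume the functions x ↦ p(x)·log(w_r·p(x)/(w_r·p(x) + w_f·q(x))) and x ↦ q(x)·log(w_f·q(x)/(w_r·p(x) + w_f·q(x))) (defined to be 0 where p(x) = 0, respectively q(x) = 0) are μ-integrable. Then w_r·∫ p·log(w_r·p/(w_r·p + w_f·q)) dμ + w_f·∫ q·log(w_f·q/(w_r·p + w_f·q)) dμ ≥ w_r·log(w_r/(w_r + w_f)) + w_f·log(w_f/(w_r + w_f)). -/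
open MeasureTheory

/-- A tangent-line lower bound for `u * log (u / s)`. -/
lemma mul_log_add_sub_le_mul_log_div {u s c : ℝ} (hu : 0 ≤ u) (hus : u ≤ s) (hc : 0 < c) :
    u * Real.log c + u - c * s ≤ u * Real.log (u / s) := by
  rcases hu.eq_or_lt with rfl | hu
  · simp only [zero_mul, zero_add, zero_sub, neg_nonpos]
    positivity
  · have hs : 0 < s := hu.trans_le hus
    have key := Real.one_sub_inv_le_log_of_pos (x := u / s / c) (by positivity)
    rw [Real.log_div (by positivity) hc.ne'] at key
    have hmul := mul_le_mul_of_nonneg_left key hu.le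
    have hinv : u * (1 - (u / s / c)⁻¹) = u - c * s := by
      field_simp
    rw [hinv] at hmul
    linarith

/-- Gibbs' inequality for two nonnegative weights `u`, `v` against the weights `a`, `b`. -/
lemma mul_log_add_mul_log_le {u v a b : ℝ} (hu : 0 ≤ u) (hv : 0 ≤ v) (ha : 0 < a) (hb : 0 < b) :
    u * Real.log (a / (a + b)) + v * Real.log (b / (a + b)) ≤
      u * Real.log (u / (u + v)) + v * Real.log (v / (u + v)) := by
  have hu' := mul_log_add_sub_le_mul_log_div (s := u + v) (c := a / (a + b)) hu
    (by linarith) (by positivity)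
  have hv' := mul_log_add_sub_le_mul_log_div (s := u + v) (c := b / (a + b)) hv
    (by linarith) (by positivity)
  have hsum : a / (a + b) * (u + v) + b / (a + b) * (u + v) = u + v := by
    field_simp
  linarith

theorem weighted_objective_lower_bound {X : Type*} [MeasurableSpace X] (μ : Measure X)
    (p q : X → ℝ) (hpm : Measurable p) (hqm : Measurable q)
    (hp0 : ∀ x, 0 ≤ p x) (hq0 : ∀ x, 0 ≤ q x)
    (hpi : ∫ x, p x ∂μ = 1) (hqi : ∫ x, q x ∂μ = 1)
    (wr wf : ℝ) (hwr : 0 < wr) (hwf : 0 < wf)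
    (h1 : Integrable
      (fun x => p x * Real.log (wr * p x / (wr * p x + wf * q x))) μ)
    (h2 : Integrable
      (fun x => q x * Real.log (wf * q x / (wr * p x + wf * q x))) μ) :
    wr * Real.log (wr / (wr + wf)) + wf * Real.log (wf / (wr + wf)) ≤
      wr * ∫ x, p x * Real.log (wr * p x / (wr * p x + wf * q x)) ∂μ +
        wf * ∫ x, q x * Real.log (wf * q x / (wr * p x + wf * q x)) ∂μ := by
  have hp : Integrable p μ := .of_integral_ne_zero (by simp [hpi])
  have hq : Integrable q μ := .of_integral_ne_zero (by simp [hqi])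
  have hl : ∫ x, (wr * Real.log (wr / (wr + wf)) * p x +
      wf * Real.log (wf / (wr + wf)) * q x) ∂μ =
      wr * Real.log (wr / (wr + wf)) + wf * Real.log (wf / (wr + wf)) := by
    rw [integral_add (hp.const_mul _) (hq.const_mul _), integral_const_mul, integral_const_mul,
      hpi, hqi, mul_one, mul_one]
  rw [← hl, ← integral_const_mul, ← integral_const_mul,
    ← integral_add (h1.const_mul _) (h2.const_mul _)]
  refine integral_mono ((hp.const_mul _).add (hq.const_mul _))
    ((h1.const_mul _).add (h2.const_mul _)) fun x => ?_
  have := mul_log_add_mul_log_le (mul_nonneg hwr.le (hp0 x)) (mul_nonneg hwf.le (hq0 x)) hwr hwf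
  dsimp only
  linarith
end

section
/- Let E be a real inner product space and let r, f be nonzero vectors in E with v = (1/‖r‖) • r + (1/‖f‖) • f nonzero. Then cos(∠(v, r)) = √((1 + cos(∠(r, f)))/2) = cos(∠(r, f)/2). -/
open RealInnerProductSpace

theorem cos_angle_add_left_of_norm_eq_one {E : Type*} [NormedAddCommGroup E]
    [InnerProductSpace ℝ E] {x y : E} (hx : ‖x‖ = 1) (hy : ‖y‖ = 1) (hxy : x + y ≠ 0) :
    Real.cos (InnerProductGeometry.angle (x + y) x) =
      Real.sqrt ((1 + Real.cos (InnerProductGeometry.angle x y)) / 2) := by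
  have hpos : 0 < ‖x + y‖ := norm_pos_iff.mpr hxy
  have hsq : ‖x + y‖ ^ 2 = 2 * (1 + ⟪x, y⟫) := by
    rw [norm_add_sq_real, hx, hy]
    ring
  have hhalf : (1 + ⟪x, y⟫) / 2 = (‖x + y‖ / 2) ^ 2 := by
    rw [div_pow, hsq]
    ring
  rw [InnerProductGeometry.cos_angle, InnerProductGeometry.cos_angle, inner_add_left,
    real_inner_self_eq_norm_sq, real_inner_comm, hx, hy, mul_one, mul_one, div_one, one_pow,
    hhalf, Real.sqrt_sq (by positivity)]
  field_simp
  linarith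

theorem aw_bisector_cos {E : Type*} [NormedAddCommGroup E] [InnerProductSpace ℝ E]
    (r f : E) (hr : r ≠ 0) (hf : f ≠ 0)
    (v : E) (hv : v = (1 / ‖r‖) • r + (1 / ‖f‖) • f) (hv0 : v ≠ 0) :
    Real.cos (InnerProductGeometry.angle v r) =
        Real.sqrt ((1 + Real.cos (InnerProductGeometry.angle r f)) / 2) ∧
      Real.sqrt ((1 + Real.cos (InnerProductGeometry.angle r f)) / 2) =
        Real.cos (InnerProductGeometry.angle r f / 2) := by
  constructor
  · subst hv
    have hr' : 0 < 1 / ‖r‖ := one_div_pos.mpr (norm_pos_iff.mpr hr)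
    have hf' : 0 < 1 / ‖f‖ := one_div_pos.mpr (norm_pos_iff.mpr hf)
    have hnr : ‖(1 / ‖r‖) • r‖ = 1 := by
      rw [one_div]
      rw [norm_smul, norm_inv, norm_norm, inv_mul_cancel₀ (norm_ne_zero_iff.mpr hr)]
    have hnf : ‖(1 / ‖f‖) • f‖ = 1 := by
      rw [one_div]
      rw [norm_smul, norm_inv, norm_norm, inv_mul_cancel₀ (norm_ne_zero_iff.mpr hf)]
    have h := cos_angle_add_left_of_norm_eq_one hnr hnf hv0
    rwa [InnerProductGeometry.angle_smul_right_of_pos _ _ hr',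
      InnerProductGeometry.angle_smul_left_of_pos _ _ hr',
      InnerProductGeometry.angle_smul_right_of_pos _ _ hf'] at h
  · have h0 := InnerProductGeometry.angle_nonneg r f
    have hpi := InnerProductGeometry.angle_le_pi r f
    exact (Real.cos_half (by linarith [Real.pi_pos]) hpi).symm
end
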